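/- arXiv:2210.09503 — 5 statements merged into one kernel-verified Lean document; each statement's English description precedes it below -/
import Mathlib

section
/- With the above setup, the average squared poisoning score of the bad points exceeds that of the clean points by at least the stated margin: (1/n_p)·∑_{x ∈ S_bad} q(x)² − (1/n)·∑_{x ∈ S_good} q(x)² ≥ ((K−1)/(K+1)·γ² − (K+1))·σ². -/
open scoped RealInnerProductSpace

theorem aux_shift {E : Type*} [NormedAddCommGroup E] [InnerProductSpace ℝ E]
    (S : Finset E) (N : ℕ) (hN : S.card = N) (h0 : (0 : ℝ) < N) (m c v : E)
    (hm : m = (N : ℝ)⁻¹ • ∑ x ∈ S, x) :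
    ∑ x ∈ S, ⟪v, x - c⟫ ^ 2 = ∑ x ∈ S, ⟪v, x - m⟫ ^ 2 + N * ⟪v, m - c⟫ ^ 2 := by
  have hs : ∑ x ∈ S, ⟪v, x - m⟫ = 0 := by
    rw [← inner_sum, Finset.sum_sub_distrib, Finset.sum_const, hN, hm, ← Nat.cast_smul_eq_nsmul ℝ,
      smul_smul, mul_inv_cancel₀ h0.ne', one_smul, sub_self, inner_zero_right]
  have h1 : ∀ x ∈ S, ⟪v, x - c⟫ ^ 2 =
      ⟪v, x - m⟫ ^ 2 + 2 * ⟪v, m - c⟫ * ⟪v, x - m⟫ + ⟪v, m - c⟫ ^ 2 := by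
    intro x _
    have : x - c = (x - m) + (m - c) := by abel
    rw [this, inner_add_right]; ring
  rw [Finset.sum_congr rfl h1, Finset.sum_add_distrib, Finset.sum_add_distrib, ← Finset.mul_sum, hs,
    Finset.sum_const, hN, nsmul_eq_mul]
  ring

/-- Theorem 1 of the paper: the average squared poisoning score of the bad
points exceeds that of the clean points by at least
`((K-1)/(K+1) * γ² - (K+1)) * σ²`. -/
theorem bad_minus_good_score_lower_bound
    {E : Type*} [NormedAddCommGroup E] [InnerProductSpace ℝ E] [DecidableEq E]
    (Sgood Sbad : Finset E) (hdisj : Disjoint Sgood Sbad)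
    (n np : ℕ) (hn : Sgood.card = n) (hnp : Sbad.card = np) (hnp0 : 0 < np)
    (K σ γ d : ℝ) (hK : 1 < K) (hσ : 0 < σ) (hγ : 0 ≤ γ)
    (hnK : (n : ℝ) = K * np)
    (μg μp μs : E)
    (hμg : μg = (n : ℝ)⁻¹ • ∑ x ∈ Sgood, x)
    (hμp : μp = (np : ℝ)⁻¹ • ∑ x ∈ Sbad, x)
    (hμs : μs = (((Sgood ∪ Sbad).card : ℝ))⁻¹ • ∑ x ∈ Sgood ∪ Sbad, x)
    (hvar : ∀ v : E, ‖v‖ = 1 →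
      (1 / (n : ℝ)) * ∑ x ∈ Sgood, ⟪v, x - μg⟫ ^ 2 ≤ σ ^ 2)
    (hd : d = γ * σ) (hdist : ‖μp - μg‖ = d)
    (V : E) (hV : ‖V‖ = 1)
    (hVtop : ∀ v : E, ‖v‖ = 1 →
      ∑ x ∈ Sgood ∪ Sbad, ⟪v, x - μs⟫ ^ 2 ≤
        ∑ x ∈ Sgood ∪ Sbad, ⟪V, x - μs⟫ ^ 2) :
    (1 / (np : ℝ)) * ∑ x ∈ Sbad, ⟪V, x - μs⟫ ^ 2 -
      (1 / (n : ℝ)) * ∑ x ∈ Sgood, ⟪V, x - μs⟫ ^ 2 ≥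
      ((K - 1) / (K + 1) * γ ^ 2 - (K + 1)) * σ ^ 2 := by
  have hp : (0 : ℝ) < np := by exact_mod_cast hnp0
  have hn0 : (0 : ℝ) < n := by rw [hnK]; positivity
  have hK1 : (0 : ℝ) < K + 1 := by linarith
  have sg : ∑ x ∈ Sgood, x = (n : ℝ) • μg := by
    rw [hμg, smul_smul, mul_inv_cancel₀ hn0.ne', one_smul]
  have sp : ∑ x ∈ Sbad, x = (np : ℝ) • μp := by
    rw [hμp, smul_smul, mul_inv_cancel₀ hp.ne', one_smul]
  have hs : μs = (K / (K + 1)) • μg + (1 / (K + 1)) • μp := by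
    rw [hμs, Finset.sum_union hdisj, Finset.card_union_of_disjoint hdisj, hn, hnp, sg, sp, smul_add,
      smul_smul, smul_smul]
    push_cast
    rw [hnK]
    congr 2 <;> field_simp
  have eg : μg - μs = (-(1 / (K + 1))) • (μp - μg) := by
    rw [hs]
    have : K / (K + 1) = 1 - 1 / (K + 1) := by field_simp; ring
    rw [this]; module
  have ep : μp - μs = (K / (K + 1)) • (μp - μg) := by
    rw [hs]
    have : 1 / (K + 1) = 1 - K / (K + 1) := by field_simp; ring
    rw [this]; module
  have G : ∀ v : E, ∑ x ∈ Sgood, ⟪v, x - μs⟫ ^ 2 =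
      ∑ x ∈ Sgood, ⟪v, x - μg⟫ ^ 2 + n * (1 / (K + 1) * ⟪v, μp - μg⟫) ^ 2 := by
    intro v
    rw [aux_shift Sgood n hn hn0 μg μs v hμg, eg, inner_smul_right]; ring
  have B : ∀ v : E, ∑ x ∈ Sbad, ⟪v, x - μs⟫ ^ 2 =
      ∑ x ∈ Sbad, ⟪v, x - μp⟫ ^ 2 + np * (K / (K + 1) * ⟪v, μp - μg⟫) ^ 2 := by
    intro v
    rw [aux_shift Sbad np hnp hp μp μs v hμp, ep, inner_smul_right]
  simp only [Finset.sum_union hdisj] at hVtop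
  have ht : ⟪V, μp - μg⟫ ^ 2 ≤ d ^ 2 := by
    have := abs_real_inner_le_norm V (μp - μg)
    rw [hV, hdist, one_mul] at this
    exact sq_le_sq' (by linarith [neg_abs_le ⟪V, μp - μg⟫]) (le_trans (le_abs_self _) this)
  have hGV : (1 / (n : ℝ)) * ∑ x ∈ Sgood, ⟪V, x - μs⟫ ^ 2 ≤ σ ^ 2 + d ^ 2 / (K + 1) ^ 2 := by
    rw [G V, mul_add]
    have h2 : (1 / (n : ℝ)) * (n * (1 / (K + 1) * ⟪V, μp - μg⟫) ^ 2)
        = ⟪V, μp - μg⟫ ^ 2 / (K + 1) ^ 2 := by field_simp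
    rw [h2]
    gcongr
    exact hvar V hV
  have hT : np * (K / (K + 1) * d ^ 2) ≤
      ∑ x ∈ Sgood, ⟪V, x - μs⟫ ^ 2 + ∑ x ∈ Sbad, ⟪V, x - μs⟫ ^ 2 := by
    by_cases h0 : d = 0
    · rw [h0]; simp only [ne_eq, OfNat.ofNat_ne_zero, not_false_eq_true, zero_pow, mul_zero]
      positivity
    · have hu : ‖d⁻¹ • (μp - μg)‖ = 1 := by
        rw [norm_smul, hdist, norm_inv, Real.norm_eq_abs,
          abs_of_nonneg (by rw [← hdist]; positivity), inv_mul_cancel₀ h0]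
      have hi : ⟪d⁻¹ • (μp - μg), μp - μg⟫ = d := by
        rw [real_inner_smul_left, real_inner_self_eq_norm_sq, hdist]; field_simp
      refine le_trans ?_ (hVtop _ hu)
      rw [G, B, hi, hnK]
      have a1 : 0 ≤ ∑ x ∈ Sgood, ⟪d⁻¹ • (μp - μg), x - μg⟫ ^ 2 := by positivity
      have a2 : 0 ≤ ∑ x ∈ Sbad, ⟪d⁻¹ • (μp - μg), x - μp⟫ ^ 2 := by positivity
      have a3 : np * (K / (K + 1) * d ^ 2) =
        K * np * (1 / (K + 1) * d) ^ 2 + np * (K / (K + 1) * d) ^ 2 := by field_simp; ring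
      linarith
  set g := ∑ x ∈ Sgood, ⟪V, x - μs⟫ ^ 2
  set b := ∑ x ∈ Sbad, ⟪V, x - μs⟫ ^ 2
  have h3 : K / (K + 1) * d ^ 2 ≤ K * ((1 / (n : ℝ)) * g) + (1 / (np : ℝ)) * b := by
    have e : K * ((1 / (n : ℝ)) * g) + (1 / (np : ℝ)) * b = (g + b) / np := by
      rw [hnK]; field_simp
    rw [e, le_div_iff₀ hp]; linarith
  have h4 := mul_le_mul_of_nonneg_left hGV hK1.le
  have e5 : ((K - 1) / (K + 1) * γ ^ 2 - (K + 1)) * σ ^ 2 =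
      K / (K + 1) * d ^ 2 - (K + 1) * (σ ^ 2 + d ^ 2 / (K + 1) ^ 2) := by
    rw [hd]; field_simp; ring
  rw [e5]
  linarith
end

section
/- Let S_good be a finite set of n points in E with mean μ_g and S_bad a disjoint finite set of n_p points with mean μ_p, where n = K·n_p for some K > 1. Let μ_s be the mean of the pooled set S = S_good ∪ S_bad, set d = ‖μ_g − μ_p‖, assume μ_p ≠ μ_s, and let v' = (μ_p − μ_s)/‖μ_p − μ_s‖ be the unit vector in the direction of the bad-group offset. Then the average squared projection of the pooled, centered data onto v' satisfies (1/|S|)·∑_{x ∈ S} ⟨v', x − μ_s⟩² ≥ K·d²/(K+1)². -/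
open scoped RealInnerProductSpace

/-- The average squared projection of the pooled centered data onto the unit
vector `v' = (μ_p − μ_s)/‖μ_p − μ_s‖` is at least `K·d²/(K+1)²`, where
`d = ‖μ_g − μ_p‖`. -/
theorem pooled_variance_along_offset_direction
    {E : Type*} [NormedAddCommGroup E] [InnerProductSpace ℝ E] [DecidableEq E]
    (Sgood Sbad : Finset E) (hdisj : Disjoint Sgood Sbad)
    (n np : ℕ) (hn : Sgood.card = n) (hnp : Sbad.card = np) (hnp0 : 0 < np)
    (K : ℝ) (hK : 1 < K) (hnK : (n : ℝ) = K * np)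
    (μg μp μs : E)
    (hμg : μg = (n : ℝ)⁻¹ • ∑ x ∈ Sgood, x)
    (hμp : μp = (np : ℝ)⁻¹ • ∑ x ∈ Sbad, x)
    (hμs : μs = (((Sgood ∪ Sbad).card : ℝ))⁻¹ • ∑ x ∈ Sgood ∪ Sbad, x)
    (d : ℝ) (hd : d = ‖μg - μp‖)
    (hne : μp ≠ μs)
    (v' : E) (hv' : v' = ‖μp - μs‖⁻¹ • (μp - μs)) :
    (1 / (((Sgood ∪ Sbad).card : ℝ))) * ∑ x ∈ Sgood ∪ Sbad, ⟪v', x - μs⟫ ^ 2 ≥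
      K * d ^ 2 / (K + 1) ^ 2 := by
  have hp : (0:ℝ) < np := by exact_mod_cast hnp0
  have hK0 : (0:ℝ) < K := by linarith
  have hn0 : (0:ℝ) < n := by rw [hnK]; positivity
  have hcard : ((Sgood ∪ Sbad).card : ℝ) = (K + 1) * np := by
    rw [Finset.card_union_of_disjoint hdisj, hn, hnp]; push_cast; rw [hnK]; ring
  have hg : ∑ x ∈ Sgood, x = (n : ℝ) • μg := by
    rw [hμg, smul_inv_smul₀ hn0.ne']
  have hb : ∑ x ∈ Sbad, x = (np : ℝ) • μp := by
    rw [hμp, smul_inv_smul₀ hp.ne']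
  have hs : (K + 1) • μs = K • μg + μp := by
    rw [hμs, hcard, Finset.sum_union hdisj, hg, hb, hnK, smul_smul, smul_add, smul_smul, smul_smul]
    congr 1
    · congr 1; field_simp
    · convert one_smul ℝ μp using 2; field_simp
  have h1 : K • (μg - μs) = -(μp - μs) := by
    have : K • μg = (K + 1) • μs - μp := by rw [hs]; abel
    rw [smul_sub, this, add_smul, one_smul]; abel
  have h2 : K • (μg - μp) = -((K + 1) • (μp - μs)) := by
    have : K • μg = (K + 1) • μs - μp := by rw [hs]; abel
    rw [smul_sub, this, smul_sub, add_smul K 1 μp, one_smul]; abel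
  obtain ⟨r, hr⟩ : ∃ r, r = ‖μp - μs‖ := ⟨_, rfl⟩
  have hr0 : 0 < r := by rw [hr]; exact norm_pos_iff.mpr (sub_ne_zero.mpr hne)
  have hrd : K * d = (K + 1) * r := by
    have := congrArg norm h2
    rw [norm_neg, norm_smul, norm_smul, Real.norm_of_nonneg hK0.le,
      Real.norm_of_nonneg (by linarith : (0:ℝ) ≤ K + 1)] at this
    rw [hd, hr, this]
  have ip : ⟪v', μp - μs⟫ = r := by
    rw [hv', real_inner_smul_left, real_inner_self_eq_norm_sq, ← hr]; field_simp
  have ig : K * ⟪v', μg - μs⟫ = -r := by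
    rw [← real_inner_smul_right, h1, inner_neg_right, ip]
  have sg : ∑ x ∈ Sgood, ⟪v', x - μs⟫ = -(np * r) := by
    rw [← inner_sum, Finset.sum_sub_distrib, hg, Finset.sum_const, hn, ← Nat.cast_smul_eq_nsmul ℝ,
      ← smul_sub, real_inner_smul_right, hnK]
    linear_combination (np:ℝ) * ig
  have sb : ∑ x ∈ Sbad, ⟪v', x - μs⟫ = np * r := by
    rw [← inner_sum, Finset.sum_sub_distrib, hb, Finset.sum_const, hnp, ← Nat.cast_smul_eq_nsmul ℝ,
      ← smul_sub, real_inner_smul_right, ip]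
  have cg := sq_sum_le_card_mul_sum_sq (s := Sgood) (f := fun x => ⟪v', x - μs⟫)
  have cb := sq_sum_le_card_mul_sum_sq (s := Sbad) (f := fun x => ⟪v', x - μs⟫)
  rw [sg, hn, hnK] at cg
  rw [sb, hnp] at cb
  rw [hcard, Finset.sum_union hdisj]
  generalize ∑ x ∈ Sgood, ⟪v', x - μs⟫ ^ 2 = A at *
  generalize ∑ x ∈ Sbad, ⟪v', x - μs⟫ ^ 2 = B at *
  have cg' : np * r ^ 2 ≤ K * A := by
    refine le_of_mul_le_mul_left ?_ hp
    linarith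
  have cb' : np * r ^ 2 ≤ B := by
    refine le_of_mul_le_mul_left ?_ hp
    linarith
  have hdr : d = (K + 1) * r / K := by field_simp; linarith
  have e : K * d ^ 2 / (K + 1) ^ 2 = r ^ 2 / K := by rw [hdr]; field_simp
  rw [e, ge_iff_le, one_div, inv_mul_eq_div, div_le_div_iff₀ hK0 (by positivity)]
  have := mul_le_mul_of_nonneg_left cb' hK0.le
  linarith
end

section
/- With the above setup, the average squared poisoning score over the pooled set is bounded below: (1/|S|)·∑_{x ∈ S} q(x)² ≥ K·d²/(K+1)², where d = ‖μ_g − μ_p‖. -/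
open scoped RealInnerProductSpace

lemma aux_sum_sq {E : Type*} [NormedAddCommGroup E] [InnerProductSpace ℝ E]
    (T : Finset E) (m c v : E) (hT : 0 < (T.card : ℝ)) (hm : (T.card : ℝ) • m = ∑ x ∈ T, x) :
    (T.card : ℝ) * ⟪v, m - c⟫ ^ 2 ≤ ∑ x ∈ T, ⟪v, x - c⟫ ^ 2 := by
  have h1 : ∑ x ∈ T, ⟪v, x - c⟫ = T.card * ⟪v, m - c⟫ := by
    rw [← inner_sum, Finset.sum_sub_distrib, ← hm, Finset.sum_const,
      ← Nat.cast_smul_eq_nsmul ℝ, ← smul_sub, inner_smul_right]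
  have h2 := sq_sum_le_card_mul_sum_sq (s := T) (f := fun x => ⟪v, x - c⟫)
  rw [h1] at h2
  refine le_of_mul_le_mul_left ?_ hT
  linarith [h2]

/-- The average squared poisoning score over the pooled set is bounded below
by `K·d²/(K+1)²`, where `d = ‖μ_g − μ_p‖`. -/
theorem pooled_average_score_lower_bound
    {E : Type*} [NormedAddCommGroup E] [InnerProductSpace ℝ E] [DecidableEq E]
    (Sgood Sbad : Finset E) (hdisj : Disjoint Sgood Sbad)
    (n np : ℕ) (hn : Sgood.card = n) (hnp : Sbad.card = np) (hnp0 : 0 < np)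
    (K : ℝ) (hK : 1 < K) (hnK : (n : ℝ) = K * np)
    (μg μp μs : E)
    (hμg : μg = (n : ℝ)⁻¹ • ∑ x ∈ Sgood, x)
    (hμp : μp = (np : ℝ)⁻¹ • ∑ x ∈ Sbad, x)
    (hμs : μs = (((Sgood ∪ Sbad).card : ℝ))⁻¹ • ∑ x ∈ Sgood ∪ Sbad, x)
    (d : ℝ) (hd : d = ‖μg - μp‖)
    (V : E) (hV : ‖V‖ = 1)
    (hVtop : ∀ v : E, ‖v‖ = 1 →
      ∑ x ∈ Sgood ∪ Sbad, ⟪v, x - μs⟫ ^ 2 ≤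
        ∑ x ∈ Sgood ∪ Sbad, ⟪V, x - μs⟫ ^ 2) :
    (1 / (((Sgood ∪ Sbad).card : ℝ))) * ∑ x ∈ Sgood ∪ Sbad, ⟪V, x - μs⟫ ^ 2 ≥
      K * d ^ 2 / (K + 1) ^ 2 := by
  have hp : (0 : ℝ) < np := by exact_mod_cast hnp0
  have hK1 : 0 < K + 1 := by linarith
  have hn0 : (0 : ℝ) < n := by rw [hnK]; positivity
  have hcard : (((Sgood ∪ Sbad).card : ℝ)) = np * (K + 1) := by
    rw [Finset.card_union_of_disjoint hdisj, hn, hnp]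
    push_cast
    rw [hnK]; ring
  have hg : (n : ℝ) • μg = ∑ x ∈ Sgood, x := by
    rw [hμg, smul_smul, mul_inv_cancel₀ hn0.ne', one_smul]
  have hb : (np : ℝ) • μp = ∑ x ∈ Sbad, x := by
    rw [hμp, smul_smul, mul_inv_cancel₀ hp.ne', one_smul]
  have hs : μs = (K / (K + 1)) • μg + (1 / (K + 1)) • μp := by
    rw [hμs, Finset.sum_union hdisj, ← hg, ← hb, hcard, smul_add, smul_smul, smul_smul, hnK]
    congr 2 <;> field_simp
  have hgs : μg - μs = (1 / (K + 1)) • (μg - μp) := by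
    rw [hs]
    match_scalars <;> field_simp
    ring
  have hps : μp - μs = (-(K / (K + 1))) • (μg - μp) := by
    rw [hs]
    match_scalars <;> field_simp
    ring
  rw [hcard, ge_iff_le]
  by_cases h0 : d = 0
  · rw [h0]
    have : 0 ≤ ∑ x ∈ Sgood ∪ Sbad, ⟪V, x - μs⟫ ^ 2 := Finset.sum_nonneg fun _ _ => sq_nonneg _
    simp only [ne_eq, OfNat.ofNat_ne_zero, not_false_eq_true, zero_pow, mul_zero, zero_div]
    positivity
  have hv := hVtop (d⁻¹ • (μg - μp)) (by
    rw [norm_smul, ← hd, Real.norm_eq_abs, abs_inv, abs_of_nonneg (by rw [hd]; positivity)]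
    exact inv_mul_cancel₀ h0)
  have hin : ⟪d⁻¹ • (μg - μp), μg - μp⟫ = d := by
    rw [real_inner_smul_left, real_inner_self_eq_norm_sq, ← hd]
    field_simp
  have a1 := aux_sum_sq Sgood μg μs (d⁻¹ • (μg - μp)) (by rw [hn]; exact hn0) (by rw [hn, hg])
  have a2 := aux_sum_sq Sbad μp μs (d⁻¹ • (μg - μp)) (by rw [hnp]; exact hp) (by rw [hnp, hb])
  rw [hgs, real_inner_smul_right, hin, hn, hnK] at a1
  rw [hps, real_inner_smul_right, hin, hnp] at a2
  rw [Finset.sum_union hdisj] at hv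
  have a3 := (add_le_add a1 a2).trans hv
  have hc : 0 < np * (K + 1) := by positivity
  rw [one_div, ← div_eq_inv_mul, le_div_iff₀ hc]
  refine le_trans (le_of_eq ?_) a3
  field_simp
  ring
end

section
/- With the above setup, for every unit vector v the average squared projection of the clean points centered at the pooled mean is bounded above: (1/n)·∑_{x ∈ S_good} ⟨v, x − μ_s⟩² ≤ σ² + d²/(K+1)², where d = ‖μ_g − μ_p‖. In particular this bound holds for the poisoning scores of the clean points: (1/n)·∑_{x ∈ S_good} q(x)² ≤ σ² + d²/(K+1)². -/
open scoped RealInnerProductSpace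

/-- For every unit vector `v`, the average squared projection of the clean
points centered at the pooled mean is at most `σ² + d²/(K+1)²`, where
`d = ‖μ_g − μ_p‖`; in particular this holds for the poisoning scores
`q(x) = ⟪V, x − μ_s⟫` of the clean points. -/
theorem clean_score_upper_bound
    {E : Type*} [NormedAddCommGroup E] [InnerProductSpace ℝ E] [DecidableEq E]
    (Sgood Sbad : Finset E) (hdisj : Disjoint Sgood Sbad)
    (n np : ℕ) (hn : Sgood.card = n) (hnp : Sbad.card = np) (hnp0 : 0 < np)
    (K σ : ℝ) (hK : 1 < K) (hσ : 0 < σ) (hnK : (n : ℝ) = K * np)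
    (μg μp μs : E)
    (hμg : μg = (n : ℝ)⁻¹ • ∑ x ∈ Sgood, x)
    (hμp : μp = (np : ℝ)⁻¹ • ∑ x ∈ Sbad, x)
    (hμs : μs = (((Sgood ∪ Sbad).card : ℝ))⁻¹ • ∑ x ∈ Sgood ∪ Sbad, x)
    (hvar : ∀ v : E, ‖v‖ = 1 →
      (1 / (n : ℝ)) * ∑ x ∈ Sgood, ⟪v, x - μg⟫ ^ 2 ≤ σ ^ 2)
    (d : ℝ) (hd : d = ‖μg - μp‖)
    (V : E) (hV : ‖V‖ = 1)
    (hVtop : ∀ v : E, ‖v‖ = 1 →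
      ∑ x ∈ Sgood ∪ Sbad, ⟪v, x - μs⟫ ^ 2 ≤
        ∑ x ∈ Sgood ∪ Sbad, ⟪V, x - μs⟫ ^ 2) :
    (∀ v : E, ‖v‖ = 1 →
      (1 / (n : ℝ)) * ∑ x ∈ Sgood, ⟪v, x - μs⟫ ^ 2 ≤ σ ^ 2 + d ^ 2 / (K + 1) ^ 2) ∧
    (1 / (n : ℝ)) * ∑ x ∈ Sgood, ⟪V, x - μs⟫ ^ 2 ≤ σ ^ 2 + d ^ 2 / (K + 1) ^ 2 := by
  have hp : (0:ℝ) < np := by exact_mod_cast hnp0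
  have hK0 : (0:ℝ) < K := by linarith
  have hK1 : (K + 1) ≠ 0 := by linarith
  have hn0 : (0:ℝ) < n := by rw [hnK]; positivity
  have hsg : ∑ x ∈ Sgood, x = (n:ℝ) • μg := by
    rw [hμg, smul_smul, mul_inv_cancel₀ hn0.ne', one_smul]
  have hsb : ∑ x ∈ Sbad, x = (np:ℝ) • μp := by
    rw [hμp, smul_smul, mul_inv_cancel₀ hp.ne', one_smul]
  have hdiff : μg - μs = (K + 1)⁻¹ • (μg - μp) := by
    rw [hμs, Finset.sum_union hdisj, Finset.card_union_of_disjoint hdisj, hn, hnp, hsg, hsb]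
    push_cast
    rw [hnK]
    have h1 : K * (np:ℝ) + np ≠ 0 := by positivity
    match_scalars
    · field_simp
      ring
    · field_simp
  have key : ∀ v : E, ‖v‖ = 1 →
      (1 / (n : ℝ)) * ∑ x ∈ Sgood, ⟪v, x - μs⟫ ^ 2 ≤ σ ^ 2 + d ^ 2 / (K + 1) ^ 2 := by
    intro v hv
    have hz : ∑ x ∈ Sgood, ⟪v, x - μg⟫ = 0 := by
      rw [← inner_sum, Finset.sum_sub_distrib, hsg, Finset.sum_const, hn,
        ← Nat.cast_smul_eq_nsmul ℝ, sub_self, inner_zero_right]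
    have hexp : ∑ x ∈ Sgood, ⟪v, x - μs⟫ ^ 2
        = ∑ x ∈ Sgood, ⟪v, x - μg⟫ ^ 2 + n * ⟪v, μg - μs⟫ ^ 2 := by
      have : ∀ x ∈ Sgood, ⟪v, x - μs⟫ ^ 2
          = ⟪v, x - μg⟫ ^ 2 + 2 * ⟪v, μg - μs⟫ * ⟪v, x - μg⟫ + ⟪v, μg - μs⟫ ^ 2 := by
        intro x _
        have : x - μs = (x - μg) + (μg - μs) := by abel
        rw [this, inner_add_right]
        ring
      rw [Finset.sum_congr rfl this, Finset.sum_add_distrib, Finset.sum_add_distrib,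
        ← Finset.mul_sum, hz, Finset.sum_const, hn, nsmul_eq_mul]
      ring
    have hb : ⟪v, μg - μs⟫ ^ 2 ≤ d ^ 2 / (K + 1) ^ 2 := by
      rw [hdiff, inner_smul_right, mul_pow, inv_pow, div_eq_inv_mul]
      have h := abs_real_inner_le_norm v (μg - μp)
      rw [hv, one_mul, ← hd] at h
      have h2 : ⟪v, μg - μp⟫ ^ 2 ≤ d ^ 2 := sq_le_sq' (abs_le.mp h).1 (abs_le.mp h).2
      gcongr
    have h3 := hvar v hv
    have h4 : (1 / (n:ℝ)) * (n * ⟪v, μg - μs⟫ ^ 2) = ⟪v, μg - μs⟫ ^ 2 := by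
      field_simp
    rw [hexp, mul_add, h4]
    linarith
  exact ⟨key, key V hV⟩
end

section
/- With the above setup, the average squared poisoning score of the bad points is bounded below: (1/n_p)·∑_{x ∈ S_bad} q(x)² ≥ K²·d²/(K+1)² − K·σ², where d = ‖μ_g − μ_p‖. -/
open scoped RealInnerProductSpace

theorem aux_decomp {E : Type*} [NormedAddCommGroup E] [InnerProductSpace ℝ E]
    (S : Finset E) (N : ℝ) (hN : (S.card : ℝ) = N) (hN0 : 0 < N) (c m v : E)
    (hc : c = N⁻¹ • ∑ x ∈ S, x) :
    ∑ x ∈ S, ⟪v, x - m⟫ ^ 2 = ∑ x ∈ S, ⟪v, x - c⟫ ^ 2 + N * ⟪v, c - m⟫ ^ 2 := by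
  have h0 : ∑ x ∈ S, ⟪v, x - c⟫ = 0 := by
    rw [← inner_sum, Finset.sum_sub_distrib, Finset.sum_const, ← Nat.cast_smul_eq_nsmul ℝ, hN, hc,
      smul_inv_smul₀ hN0.ne', sub_self, inner_zero_right]
  have h1 : ∀ x ∈ S, ⟪v, x - m⟫ ^ 2 =
      ⟪v, x - c⟫ ^ 2 + 2 * ⟪v, c - m⟫ * ⟪v, x - c⟫ + ⟪v, c - m⟫ ^ 2 := by
    intro x _
    have : x - m = (x - c) + (c - m) := by abel
    rw [this, inner_add_right]; ring
  rw [Finset.sum_congr rfl h1, Finset.sum_add_distrib, Finset.sum_add_distrib, ← Finset.mul_sum,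
    h0, Finset.sum_const, nsmul_eq_mul, hN]
  ring

/-- The average squared poisoning score of the bad points is bounded below by
`K²·d²/(K+1)² − K·σ²`, where `d = ‖μ_g − μ_p‖`. -/
theorem bad_score_lower_bound
    {E : Type*} [NormedAddCommGroup E] [InnerProductSpace ℝ E] [DecidableEq E]
    (Sgood Sbad : Finset E) (hdisj : Disjoint Sgood Sbad)
    (n np : ℕ) (hn : Sgood.card = n) (hnp : Sbad.card = np) (hnp0 : 0 < np)
    (K σ : ℝ) (hK : 1 < K) (hσ : 0 < σ) (hnK : (n : ℝ) = K * np)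
    (μg μp μs : E)
    (hμg : μg = (n : ℝ)⁻¹ • ∑ x ∈ Sgood, x)
    (hμp : μp = (np : ℝ)⁻¹ • ∑ x ∈ Sbad, x)
    (hμs : μs = (((Sgood ∪ Sbad).card : ℝ))⁻¹ • ∑ x ∈ Sgood ∪ Sbad, x)
    (hvar : ∀ v : E, ‖v‖ = 1 →
      (1 / (n : ℝ)) * ∑ x ∈ Sgood, ⟪v, x - μg⟫ ^ 2 ≤ σ ^ 2)
    (d : ℝ) (hd : d = ‖μg - μp‖)
    (V : E) (hV : ‖V‖ = 1)
    (hVtop : ∀ v : E, ‖v‖ = 1 →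
      ∑ x ∈ Sgood ∪ Sbad, ⟪v, x - μs⟫ ^ 2 ≤
        ∑ x ∈ Sgood ∪ Sbad, ⟪V, x - μs⟫ ^ 2) :
    (1 / (np : ℝ)) * ∑ x ∈ Sbad, ⟪V, x - μs⟫ ^ 2 ≥
      K ^ 2 * d ^ 2 / (K + 1) ^ 2 - K * σ ^ 2 := by
  have hp : (0 : ℝ) < np := by exact_mod_cast hnp0
  have hK0 : 0 < K := by linarith
  have hn0 : (0 : ℝ) < n := by rw [hnK]; positivity
  have hK1 : K + 1 ≠ 0 := by positivity
  have hcard : ((Sgood ∪ Sbad).card : ℝ) = (K + 1) * np := by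
    rw [Finset.card_union_of_disjoint hdisj, hn, hnp]; push_cast; rw [hnK]; ring
  have hsg : ∑ x ∈ Sgood, x = (n : ℝ) • μg := by rw [hμg, smul_inv_smul₀ hn0.ne']
  have hsp : ∑ x ∈ Sbad, x = (np : ℝ) • μp := by rw [hμp, smul_inv_smul₀ hp.ne']
  have hs : μs = (K / (K + 1)) • μg + (1 / (K + 1)) • μp := by
    rw [hμs, hcard, Finset.sum_union hdisj, hsg, hsp, hnK, smul_add, smul_smul, smul_smul]
    congr 2 <;> field_simp
  have e1 : μg - μs = (1 / (K + 1)) • (μg - μp) := by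
    have : (K / (K + 1)) = 1 - 1 / (K + 1) := by field_simp; ring
    rw [hs, this]; module
  have e2 : μp - μs = (-(K / (K + 1))) • (μg - μp) := by
    have : (1 / (K + 1)) = 1 - K / (K + 1) := by field_simp; ring
    rw [hs, this]; module
  have hG : ∀ v : E, ∑ x ∈ Sgood, ⟪v, x - μs⟫ ^ 2 = ∑ x ∈ Sgood, ⟪v, x - μg⟫ ^ 2
      + np * (K * ⟪v, μg - μp⟫ ^ 2 / (K + 1) ^ 2) := by
    intro v
    rw [aux_decomp Sgood n (by rw [hn]) hn0 μg μs v hμg, e1, inner_smul_right, hnK]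
    field_simp
  have hB : ∀ v : E, ∑ x ∈ Sbad, ⟪v, x - μs⟫ ^ 2 = ∑ x ∈ Sbad, ⟪v, x - μp⟫ ^ 2
      + np * (K ^ 2 * ⟪v, μg - μp⟫ ^ 2 / (K + 1) ^ 2) := by
    intro v
    rw [aux_decomp Sbad np (by rw [hnp]) hp μp μs v hμp, e2, inner_smul_right]
    field_simp
  have hB0 : 0 ≤ ∑ x ∈ Sbad, ⟪V, x - μs⟫ ^ 2 := Finset.sum_nonneg fun _ _ => sq_nonneg _
  rw [ge_iff_le, one_div, inv_mul_eq_div, le_div_iff₀ hp]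
  by_cases hd0 : d = 0
  · refine le_trans ?_ hB0
    rw [hd0]
    have : 0 < K * σ ^ 2 * np := by positivity
    simp only [ne_eq, OfNat.ofNat_ne_zero, not_false_eq_true, zero_pow, mul_zero, zero_div]
    linarith
  have hu : ‖d⁻¹ • (μg - μp)‖ = 1 := by
    have : 0 ≤ d := hd ▸ norm_nonneg _
    rw [norm_smul, ← hd, norm_inv, Real.norm_of_nonneg this, inv_mul_cancel₀ hd0]
  have hi : ⟪d⁻¹ • (μg - μp), μg - μp⟫ = d := by
    rw [real_inner_smul_left, real_inner_self_eq_norm_sq, ← hd]; field_simp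
  have ht := hVtop _ hu
  rw [Finset.sum_union hdisj, Finset.sum_union hdisj, hG, hB, hi, hG V] at ht
  have p1 : 0 ≤ ∑ x ∈ Sgood, ⟪d⁻¹ • (μg - μp), x - μg⟫ ^ 2 :=
    Finset.sum_nonneg fun _ _ => sq_nonneg _
  have p2 : 0 ≤ ∑ x ∈ Sbad, ⟪d⁻¹ • (μg - μp), x - μp⟫ ^ 2 :=
    Finset.sum_nonneg fun _ _ => sq_nonneg _
  have p3 := hvar V hV
  rw [one_div, inv_mul_eq_div, div_le_iff₀ hn0, hnK] at p3
  have p4 : ⟪V, μg - μp⟫ ^ 2 ≤ d ^ 2 := by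
    have h := abs_real_inner_le_norm V (μg - μp)
    rw [hV, one_mul, ← hd] at h
    rw [← sq_abs]
    gcongr
  have p5 : np * (K * ⟪V, μg - μp⟫ ^ 2 / (K + 1) ^ 2) ≤ np * (K * d ^ 2 / (K + 1) ^ 2) := by
    gcongr
  linarith
end
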